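/- Let X be a separable almost Daugavet space and suppose X = J ⊕_1 Ĵ is an L-decomposition into two closed subspaces. Then J or Ĵ has the almost Daugavet property. -/

import Mathlib

/-- `Y ⊆ X*` is norming: `sup {|f x| : f ∈ Y, ‖f‖ ≤ 1} = ‖x‖` for every `x`. -/
def IsNormingSubspace {X : Type*} [NormedAddCommGroup X] [NormedSpace ℝ X]
    (Y : Subspace ℝ (X →L[ℝ] ℝ)) : Prop :=
  ∀ x : X, ‖x‖ = sSup {r : ℝ | ∃ f ∈ Y, ‖f‖ ≤ 1 ∧ r = |f x|}

/-- `X` has the Daugavet property with respect to `Y ⊆ X*`. -/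
def HasDaugavetWrt {X : Type*} [NormedAddCommGroup X] [NormedSpace ℝ X]
    (Y : Subspace ℝ (X →L[ℝ] ℝ)) : Prop :=
  ∀ (x : X), ∀ f ∈ Y,
    ‖ContinuousLinearMap.id ℝ X + ContinuousLinearMap.smulRight f x‖ =
      1 + ‖ContinuousLinearMap.smulRight f x‖

/-- `X` is an almost Daugavet space. -/
def AlmostDaugavet (X : Type*) [NormedAddCommGroup X] [NormedSpace ℝ X] : Prop :=
  ∃ Y : Subspace ℝ (X →L[ℝ] ℝ), IsNormingSubspace Y ∧ HasDaugavetWrt Y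


/-- Thickness two: no finite inner `(2-ε)`-net. -/
def ThickTwo (X : Type*) [NormedAddCommGroup X] : Prop :=
  ∀ F : Finset X, (∀ a ∈ F, ‖a‖ = 1) → ∀ ε : ℝ, 0 < ε →
    ∃ e : X, ‖e‖ = 1 ∧ ∀ a ∈ F, 2 - ε ≤ ‖a + e‖

section aux
variable {X : Type*} [NormedAddCommGroup X] [NormedSpace ℝ X]

lemma norming_exists {Y : Subspace ℝ (X →L[ℝ] ℝ)} (hY : IsNormingSubspace Y) (x : X) (c : ℝ)
    (hc : c < ‖x‖) : ∃ f ∈ Y, ‖f‖ ≤ 1 ∧ c < f x := by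
  rw [hY x] at hc
  have hne : {r : ℝ | ∃ f ∈ Y, ‖f‖ ≤ 1 ∧ r = |f x|}.Nonempty := ⟨_, 0, Y.zero_mem, by simp, rfl⟩
  obtain ⟨r, ⟨f, hf, hf1, rfl⟩, hr⟩ := exists_lt_of_lt_csSup hne hc
  rcases le_total 0 (f x) with h | h
  · exact ⟨f, hf, hf1, by rwa [abs_of_nonneg h] at hr⟩
  · exact ⟨-f, Y.neg_mem hf, by simpa using hf1, by rw [abs_of_nonpos h] at hr; simpa using hr⟩

lemma exists_unit_ball_lt {W : Type*} [NormedAddCommGroup W] [NormedSpace ℝ W]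
    (T : X →L[ℝ] W) (c : ℝ) (hc : c < ‖T‖) : ∃ y : X, ‖y‖ ≤ 1 ∧ c < ‖T y‖ := by
  by_contra! h
  have h0 : 0 ≤ c := le_trans (norm_nonneg _) (h 0 (by simp))
  have := T.opNorm_le_of_unit_norm (C := c) h0 (fun x hx => h x hx.le)
  linarith

lemma slice_step {Y : Subspace ℝ (X →L[ℝ] ℝ)} (hY : IsNormingSubspace Y) (hD : HasDaugavetWrt Y)
    (x : X) (hx : ‖x‖ = 1) (f : X →L[ℝ] ℝ) (hf : f ∈ Y) (hf1 : ‖f‖ = 1) (c : ℝ) (hc : c < 1)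
    (ε : ℝ) (hε : 0 < ε) :
    ∃ g ∈ Y, ‖g‖ = 1 ∧ ∃ d < 1, ∀ z : X, ‖z‖ ≤ 1 → d < g z → c < f z ∧ 2 - ε ≤ ‖x + z‖ := by
  obtain ⟨η, hη, hη1, hη2, hη3⟩ : ∃ η : ℝ, 0 < η ∧ η ≤ ε ∧ η ≤ 1 - c ∧ η ≤ 1/2 :=
    ⟨min ε (min (1 - c) (1/2)), by simp [hε, hc], by simp, by simp, by simp⟩
  have h1 : ‖ContinuousLinearMap.id ℝ X + ContinuousLinearMap.smulRight f x‖ = 2 := by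
    rw [hD x f hf, ContinuousLinearMap.norm_smulRight_apply, hf1, hx]; norm_num
  obtain ⟨y, hy1, hy2⟩ := exists_unit_ball_lt _ (2 - η) (by rw [h1]; linarith)
  obtain ⟨y, hy1, hy2, hy3⟩ : ∃ y : X, ‖y‖ ≤ 1 ∧ 2 - η < ‖y + f y • x‖ ∧ 0 ≤ f y := by
    rcases le_total 0 (f y) with h | h
    · exact ⟨y, hy1, by simpa using hy2, h⟩
    · refine ⟨-y, by simpa using hy1, ?_, by simpa using h⟩
      have : -y + f (-y) • x = -(y + f y • x) := by simp [add_comm]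
      rw [this, norm_neg]
      simpa using hy2
  obtain ⟨p, hp, hp1, hp2⟩ := norming_exists hY _ _ hy2
  have bd : ∀ (q : X →L[ℝ] ℝ) (z : X), ‖q‖ ≤ 1 → ‖z‖ ≤ 1 → q z ≤ 1 := fun q z hq hz => by
    have := q.le_of_opNorm_le hq z
    rw [Real.norm_eq_abs] at this
    linarith [le_abs_self (q z)]
  have hpx := bd p x hp1 hx.le
  have hpy := bd p y hp1 hy1
  have hfy := bd f y hf1.le hy1
  simp only [map_add, map_smul, smul_eq_mul] at hp2
  have hpx0 : 0 < p x := by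
    by_contra! hh
    nlinarith
  set g : X →L[ℝ] ℝ := p + p x • f with hg
  have hgy : 2 - η < g y := by simp [hg]; linarith
  have hgn : 2 - η < ‖g‖ := by
    have := g.le_opNorm y
    rw [Real.norm_eq_abs] at this
    have h3 := le_abs_self (g y)
    nlinarith [norm_nonneg g]
  have hgp : 0 < ‖g‖ := by linarith
  refine ⟨‖g‖⁻¹ • g, Y.smul_mem _ (Y.add_mem hp (Y.smul_mem _ hf)), ?_, (2 - η) / ‖g‖, ?_, ?_⟩
  · rw [norm_smul, norm_inv, norm_norm, inv_mul_cancel₀ hgp.ne']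
  · rw [div_lt_one hgp]; exact hgn
  · intro z hz hd
    have hgz : 2 - η < g z := by
      rw [smul_apply, smul_eq_mul, div_eq_inv_mul] at hd
      exact lt_of_mul_lt_mul_left hd (by positivity)
    simp [hg] at hgz
    have hpz := bd p z hp1 hz
    have hfz := bd f z hf1.le hz
    have hfz0 : 0 < f z := by
      by_contra! hh
      nlinarith
    refine ⟨by nlinarith, ?_⟩
    have h5 : p (x + z) ≤ ‖x + z‖ := by
      have := p.le_of_opNorm_le hp1 (x + z)
      rw [Real.norm_eq_abs] at this
      linarith [le_abs_self (p (x + z))]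
    rw [map_add] at h5
    nlinarith

lemma thick_of_ad (h : AlmostDaugavet X) : ThickTwo X := by
  obtain ⟨Y, hY, hD⟩ := h
  have hid : ‖ContinuousLinearMap.id ℝ X‖ = 1 := by
    have := hD 0 0 Y.zero_mem
    simpa using this
  intro F hF ε hε
  have key : ∃ g ∈ Y, ‖g‖ = 1 ∧ ∃ d < 1, ∀ z : X, ‖z‖ ≤ 1 → d < g z →
      ∀ a ∈ F, 2 - ε ≤ ‖a + z‖ := by
    classical
    induction F using Finset.induction_on with
    | empty =>
      obtain ⟨y, hy, hy2⟩ := exists_unit_ball_lt (ContinuousLinearMap.id ℝ X) 0 (by rw [hid]; simp)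
      obtain ⟨p, hp, hp1, hp2⟩ := norming_exists hY y 0 (by simpa using hy2)
      have hp0 : p ≠ 0 := by rintro rfl; simp at hp2
      refine ⟨‖p‖⁻¹ • p, Y.smul_mem _ hp, ?_, 0, by simp, by simp⟩
      rw [norm_smul, norm_inv, norm_norm, inv_mul_cancel₀ (norm_ne_zero_iff.2 hp0)]
    | insert a F ha ih =>
      obtain ⟨f, hf, hf1, c, hc, hz⟩ := ih (fun b hb => hF b (Finset.mem_insert_of_mem hb))
      obtain ⟨g, hg, hg1, d, hd, hz2⟩ :=
        slice_step hY hD a (hF a (Finset.mem_insert_self _ _)) f hf hf1 c hc ε hε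
      refine ⟨g, hg, hg1, d, hd, fun z h1 h2 b hb => ?_⟩
      rcases Finset.mem_insert.1 hb with rfl | hb
      · exact (hz2 z h1 h2).2
      · exact hz z h1 (hz2 z h1 h2).1 b hb
  obtain ⟨g, hg, hg1, d, hd, hz⟩ := key
  obtain ⟨y, hy, hy2⟩ := exists_unit_ball_lt g (max d 0) (by rw [hg1]; simp [hd])
  rw [Real.norm_eq_abs, max_lt_iff] at hy2
  obtain ⟨y, hy, hy2, hy3⟩ : ∃ y : X, ‖y‖ ≤ 1 ∧ d < g y ∧ 0 < g y := by
    rcases le_total 0 (g y) with h | h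
    · rw [abs_of_nonneg h] at hy2; exact ⟨y, hy, hy2⟩
    · rw [abs_of_nonpos h] at hy2; exact ⟨-y, by simpa using hy, by simpa using hy2⟩
  have hy0 : y ≠ 0 := by rintro rfl; simp at hy3
  have hn : 0 < ‖y‖ := norm_pos_iff.2 hy0
  have hu : ‖‖y‖⁻¹ • y‖ = 1 := by rw [norm_smul, norm_inv, norm_norm, inv_mul_cancel₀ hn.ne']
  refine ⟨‖y‖⁻¹ • y, hu, hz _ hu.le ?_⟩
  rw [map_smul, smul_eq_mul]
  have : 1 ≤ ‖y‖⁻¹ := (one_le_inv₀ hn).2 hy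
  nlinarith

lemma half_case (J : Subspace ℝ X) (F : Finset J) (ε : ℝ) (hε : 0 < ε)
    (hF1 : ∀ a ∈ F, ‖a‖ = 1)
    (hF : ∀ e : J, ‖e‖ = 1 → ∃ a ∈ F, ‖a + e‖ < 2 - ε) (j jh : X) (hj : j ∈ J)
    (hs : ‖j‖ + ‖jh‖ = 1) (hh : 1/2 ≤ ‖j‖) : ∃ a ∈ F, ‖(a : X) + (j + jh)‖ < 2 - ε / 2 := by
  have hn : 0 < ‖j‖ := by linarith
  have hu : ‖‖j‖⁻¹ • (⟨j, hj⟩ : J)‖ = 1 := by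
    rw [norm_smul, norm_inv, norm_norm]; exact inv_mul_cancel₀ hn.ne'
  obtain ⟨a, ha, h⟩ := hF _ hu
  refine ⟨a, ha, ?_⟩
  have h' : ‖(a : X) + ‖j‖⁻¹ • j‖ < 2 - ε := h
  have e1 : (a : X) + (j + jh) = (1 - ‖j‖) • (a : X) + ‖j‖ • ((a : X) + ‖j‖⁻¹ • j) + jh := by
    rw [smul_add, smul_smul, mul_inv_cancel₀ hn.ne']; module
  have ha1 : ‖(a : X)‖ = 1 := hF1 a ha
  have hj1 : ‖j‖ ≤ 1 := by linarith [norm_nonneg jh]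
  have n1 : ‖(1 - ‖j‖) • (a : X)‖ = 1 - ‖j‖ := by
    rw [norm_smul, ha1, Real.norm_of_nonneg (by linarith), mul_one]
  have n2 : ‖‖j‖ • ((a : X) + ‖j‖⁻¹ • j)‖ = ‖j‖ * ‖(a : X) + ‖j‖⁻¹ • j‖ := by
    rw [norm_smul, norm_norm]
  rw [e1]
  have := norm_add₃_le (a := (1 - ‖j‖) • (a : X)) (b := ‖j‖ • ((a : X) + ‖j‖⁻¹ • j)) (c := jh)
  rw [n1, n2] at this
  nlinarith

lemma thick_split (hX : ThickTwo X) (J Jhat : Subspace ℝ X)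
    (hsum : ∀ x : X, ∃ j ∈ J, ∃ jh ∈ Jhat, x = j + jh)
    (hL : ∀ j ∈ J, ∀ jh ∈ Jhat, ‖j + jh‖ = ‖j‖ + ‖jh‖) : ThickTwo J ∨ ThickTwo Jhat := by
  classical
  by_contra! hcon
  obtain ⟨h1, h2⟩ := hcon
  unfold ThickTwo at h1 h2
  push Not at h1 h2
  obtain ⟨F, hF1, ε, hε, hF⟩ := h1
  obtain ⟨G, hG1, δ, hδ, hG⟩ := h2
  obtain ⟨e, he1, he⟩ := hX (F.image (fun a : J => (a : X)) ∪ G.image (fun a : Jhat => (a : X))) (by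
    intro a ha
    rcases Finset.mem_union.1 ha with ha | ha
    · obtain ⟨b, hb, rfl⟩ := Finset.mem_image.1 ha
      exact hF1 b hb
    · obtain ⟨b, hb, rfl⟩ := Finset.mem_image.1 ha
      exact hG1 b hb) (min (ε/2) (δ/2)) (by positivity)
  obtain ⟨j, hj, jh, hjh, rfl⟩ := hsum e
  rw [hL j hj jh hjh] at he1
  rcases le_total (1/2) ‖j‖ with h | h
  · obtain ⟨a, ha, hlt⟩ := half_case J F ε hε hF1 hF j jh hj he1 h
    have := he a (Finset.mem_union_left _ (Finset.mem_image_of_mem _ ha))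
    linarith [min_le_left (ε/2) (δ/2)]
  · obtain ⟨a, ha, hlt⟩ := half_case Jhat G δ hδ hG1 hG jh j hjh (by linarith) (by linarith)
    have := he a (Finset.mem_union_right _ (Finset.mem_image_of_mem _ ha))
    rw [add_comm jh j] at hlt
    linarith [min_le_right (ε/2) (δ/2)]

lemma thick_fd (hX : ThickTwo X) (G : Submodule ℝ X) (hG : FiniteDimensional ℝ G)
    (c : ℝ) (hc : c < 1) :
    ∃ e : X, ‖e‖ = 1 ∧ ∀ u ∈ G, ∀ a : ℝ, c * (‖u‖ + |a|) ≤ ‖u + a • e‖ := by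
  classical
  set δ := (1 - c) / 2 with hδ
  have hδ0 : 0 < δ := by rw [hδ]; linarith
  have hcomp : IsCompact (Metric.sphere (0 : G) 1) := by
    have := FiniteDimensional.proper ℝ G
    exact isCompact_sphere _ _
  obtain ⟨t, ht, htf, hcov⟩ := hcomp.finite_cover_balls hδ0
  obtain ⟨e, he, he2⟩ := hX (htf.toFinset.image (fun a : G => (a : X))) (by
    intro a ha
    obtain ⟨b, hb, rfl⟩ := Finset.mem_image.1 ha
    have := ht (htf.mem_toFinset.1 hb)
    simpa using this) δ hδ0
  have unit : ∀ v ∈ G, ‖v‖ = 1 → 1 + c ≤ ‖v + e‖ := by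
    intro v hv hv1
    have hm : (⟨v, hv⟩ : G) ∈ Metric.sphere (0 : G) 1 := by simpa using hv1
    have := hcov hm
    simp only [Set.mem_iUnion, exists_prop] at this
    obtain ⟨b, hb, hvb⟩ := this
    have h1 := he2 b (Finset.mem_image_of_mem _ (htf.mem_toFinset.2 hb))
    rw [Metric.mem_ball, dist_comm, dist_eq_norm] at hvb
    have h2 : ‖(b : X) - v‖ < δ := hvb
    have h3 : (b : X) + e = (b - v) + (v + e) := by abel
    rw [h3] at h1
    have := norm_add_le ((b : X) - v) (v + e)
    linarith
  have pos : ∀ v ∈ G, ‖v‖ = 1 → ∀ p q : ℝ, 0 ≤ p → 0 ≤ q → c * (p + q) ≤ ‖p • v + q • e‖ := by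
    intro v hv hv1 p q hp hq
    have hu := unit v hv hv1
    rcases le_total p q with h | h
    · have e1 : q • (v + e) = (p • v + q • e) + (q - p) • v := by module
      have := norm_add_le (p • v + q • e) ((q - p) • v)
      rw [← e1, norm_smul, norm_smul, hv1, Real.norm_of_nonneg hq,
        Real.norm_of_nonneg (by linarith)] at this
      nlinarith
    · have e1 : p • (v + e) = (p • v + q • e) + (p - q) • e := by module
      have := norm_add_le (p • v + q • e) ((p - q) • e)
      rw [← e1, norm_smul, norm_smul, he, Real.norm_of_nonneg hp,
        Real.norm_of_nonneg (by linarith)] at this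
      nlinarith
  have pos2 : ∀ u ∈ G, ∀ q : ℝ, 0 ≤ q → c * (‖u‖ + q) ≤ ‖u + q • e‖ := by
    intro u hu q hq
    by_cases h0 : u = 0
    · subst h0
      simp only [norm_zero, zero_add, norm_smul, he, Real.norm_of_nonneg hq]
      nlinarith
    · have hn : 0 < ‖u‖ := norm_pos_iff.2 h0
      have := pos (‖u‖⁻¹ • u) (G.smul_mem _ hu)
        (by rw [norm_smul, norm_inv, norm_norm, inv_mul_cancel₀ hn.ne']) ‖u‖ q hn.le hq
      rwa [smul_smul, mul_inv_cancel₀ hn.ne', one_smul] at this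
  refine ⟨e, he, fun u hu a => ?_⟩
  rcases le_total 0 a with h | h
  · rw [abs_of_nonneg h]; exact pos2 u hu a h
  · have := pos2 (-u) (G.neg_mem hu) (-a) (by linarith)
    rw [abs_of_nonpos h]
    rwa [norm_neg, neg_smul, ← neg_add, norm_neg] at this

/-- The basic sequence. -/
lemma exists_seq_e (hX : ThickTwo X) (σ : ℕ → X) (c : ℕ → ℝ) (hc : ∀ k, c k < 1) :
    ∃ (e : ℕ → X) (H : ℕ → Submodule ℝ X), Monotone H ∧ (∀ k, ‖e k‖ = 1) ∧
      (∀ k, σ k ∈ H (k+1)) ∧ (∀ k, e k ∈ H (k+1)) ∧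
      (∀ k, ∀ u ∈ H k, ∀ b a : ℝ,
        c k * (‖u + b • σ k‖ + |a|) ≤ ‖(u + b • σ k) + a • e k‖) := by
  have h := fun (G : Submodule ℝ X) (hG : FiniteDimensional ℝ G) (k : ℕ) =>
    thick_fd hX G hG (c k) (hc k)
  choose! E hE1 hE2 using h
  let H : ℕ → Submodule ℝ X := fun n => Nat.rec (motive := fun _ => Submodule ℝ X) ⊥
    (fun k (G : Submodule ℝ X) => (G ⊔ Submodule.span ℝ {σ k}) ⊔
      Submodule.span ℝ {E (G ⊔ Submodule.span ℝ {σ k}) k}) n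
  have Hs : ∀ k, H (k+1) = (H k ⊔ Submodule.span ℝ {σ k}) ⊔
      Submodule.span ℝ {E (H k ⊔ Submodule.span ℝ {σ k}) k} := fun k => rfl
  have fd : ∀ k, FiniteDimensional ℝ (H k) := by
    intro k
    induction k with
    | zero => exact (inferInstance : FiniteDimensional ℝ (⊥ : Submodule ℝ X))
    | succ k ih => rw [Hs]; infer_instance
  have fd' : ∀ k, FiniteDimensional ℝ (H k ⊔ Submodule.span ℝ {σ k} : Submodule ℝ X) := by
    intro k
    have := fd k
    infer_instance
  refine ⟨fun k => E (H k ⊔ Submodule.span ℝ {σ k}) k, H, ?_, ?_, ?_, ?_, ?_⟩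
  · exact monotone_nat_of_le_succ fun k => by rw [Hs]; exact le_sup_left.trans le_sup_left
  · exact fun k => hE1 _ (fd' k) k
  · intro k
    rw [Hs]
    exact (le_sup_right.trans le_sup_left : Submodule.span ℝ {σ k} ≤ _)
      (Submodule.mem_span_singleton_self _)
  · intro k
    rw [Hs]
    exact Submodule.mem_sup_right (Submodule.mem_span_singleton_self _)
  · intro k u hu b a
    exact hE2 _ (fd' k) k _ (Submodule.add_mem_sup hu
      (Submodule.smul_mem _ _ (Submodule.mem_span_singleton_self _))) a

lemma exists_functional (Z : Submodule ℝ X) (x : X) (r : ℝ) (h : ∀ z ∈ Z, r ≤ ‖x + z‖) :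
    ∃ f : X →L[ℝ] ℝ, ‖f‖ ≤ 1 ∧ r ≤ f x ∧ ∀ z ∈ Z, f z = 0 := by
  set W := Z.topologicalClosure with hW
  have : IsClosed (W : Set X) := Z.isClosed_topologicalClosure
  have hWb : ∀ z ∈ W, r ≤ ‖x + z‖ := by
    intro z hz
    have hcl : IsClosed {z : X | r ≤ ‖x + z‖} := isClosed_le (by fun_prop) (by fun_prop)
    exact closure_minimal (fun z hz => h z hz) hcl hz
  obtain ⟨g, hg1, hg2⟩ := exists_dual_vector'' ℝ (W.mkQ x)
  have hle : ∀ y, ‖W.mkQ y‖ ≤ ‖y‖ := fun y => Submodule.Quotient.norm_mk_le W y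
  let f : X →ₗ[ℝ] ℝ := g.toLinearMap.comp W.mkQ
  have hf : ∀ y, ‖f y‖ ≤ 1 * ‖y‖ := fun y => by
    have := g.le_of_opNorm_le hg1 (W.mkQ y)
    calc ‖f y‖ ≤ 1 * ‖W.mkQ y‖ := this
      _ ≤ 1 * ‖y‖ := by linarith [hle y]
  refine ⟨f.mkContinuous 1 hf, f.mkContinuous_norm_le zero_le_one hf, ?_, ?_⟩
  · have : f x = ‖W.mkQ x‖ := hg2
    rw [LinearMap.mkContinuous_apply, this]
    by_contra! hlt
    obtain ⟨m, hm, hml⟩ := Submodule.Quotient.norm_mk_lt (W.mkQ x) (sub_pos.2 hlt)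
    have hmem : m - x ∈ W := by
      rw [← Submodule.Quotient.mk_eq_zero, Submodule.Quotient.mk_sub, hm]; simp
    have := hWb _ hmem
    rw [add_sub_cancel] at this
    linarith
  · intro z hz
    have : W.mkQ z = 0 := by
      simpa using Z.le_topologicalClosure hz
    show g (W.mkQ z) = 0
    rw [this, map_zero]

lemma ad_of_thick [TopologicalSpace.SeparableSpace X] (hX : ThickTwo X) : AlmostDaugavet X := by
  obtain ⟨v0, hv0, -⟩ := hX ∅ (by simp) 1 one_pos
  have : Nonempty (Metric.sphere (0 : X) 1) := ⟨⟨v0, by simpa using hv0⟩⟩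
  have : SecondCountableTopology X := UniformSpace.secondCountable_of_separable X
  have : Nontrivial X := ⟨v0, 0, by rintro rfl; simp at hv0⟩
  obtain ⟨s, hs⟩ := TopologicalSpace.exists_dense_seq (Metric.sphere (0 : X) 1)
  set σ : ℕ → X := fun k => (s (Nat.unpair k).1 : X) with hσ
  have hσ1 : ∀ k, ‖σ k‖ = 1 := fun k => mem_sphere_zero_iff_norm.1 (s (Nat.unpair k).1).2
  -- density, infinitely often
  have hdense : ∀ v : X, ‖v‖ = 1 → ∀ ε > 0, ∀ N : ℕ, ∃ k ≥ N, ‖v - σ k‖ < ε := by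
    intro v hv ε hε N
    obtain ⟨n, hn⟩ := hs.exists_dist_lt (⟨v, by simpa using hv⟩ : Metric.sphere (0 : X) 1) hε
    refine ⟨Nat.pair n N, Nat.right_le_pair n N, ?_⟩
    simp only [hσ, Nat.unpair_pair]
    rw [← dist_eq_norm]
    exact hn
  let c : ℕ → ℝ := fun k => 1 - 1 / ((k : ℝ) + 2)
  have hcpos : ∀ k, 0 < c k := fun k => by
    have : 1 / ((k : ℝ) + 2) < 1 := by rw [div_lt_one (by positivity)]; linarith [k.cast_nonneg (α := ℝ)]
    simp only [c]; linarith
  have hclt : ∀ k, c k < 1 := fun k => by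
    have : 0 < 1 / ((k : ℝ) + 2) := by positivity
    simp only [c]; linarith
  have hcmono : ∀ k, c k < c (k+1) := fun k => by
    have : 1 / (((k+1 : ℕ) : ℝ) + 2) < 1 / ((k : ℝ) + 2) := by
      apply one_div_lt_one_div_of_lt (by positivity)
      push_cast; linarith
    simp only [c]; linarith
  have hclim : Filter.Tendsto c Filter.atTop (nhds 1) := by
    have : Filter.Tendsto (fun k : ℕ => 1 / ((k : ℝ) + 2)) Filter.atTop (nhds 0) := by
      have := (tendsto_one_div_add_atTop_nhds_zero_nat (𝕜 := ℝ)).comp (Filter.tendsto_add_atTop_nat 1)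
      refine this.congr fun k => ?_
      simp only [Function.comp]; push_cast; ring_nf
    have h2 := this.const_sub 1
    rw [sub_zero] at h2
    exact h2
  obtain ⟨e, H, hmono, he1, hσH, heH, hkey⟩ := exists_seq_e hX σ (fun k => c k / c (k+1))
    (fun k => by rw [div_lt_one (hcpos _)]; exact hcmono k)
  have hkey' : ∀ k, ∀ u ∈ H k, ∀ b a : ℝ,
      c k * (‖u + b • σ k‖ + |a|) ≤ c (k+1) * ‖(u + b • σ k) + a • e k‖ := by
    intro k u hu b a
    have := hkey k u hu b a
    rw [div_mul_eq_mul_div, div_le_iff₀ (hcpos _)] at this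
    linarith
  -- approximation by elements of the `H k`
  have happ : ∀ x : X, ∀ ε > 0, ∃ N, ∃ u ∈ H N, ‖x - u‖ ≤ ε := by
    intro x ε hε
    by_cases h0 : x = 0
    · exact ⟨0, 0, Submodule.zero_mem _, by simp [h0, hε.le]⟩
    · have hn : 0 < ‖x‖ := norm_pos_iff.2 h0
      obtain ⟨k, -, hk⟩ := hdense (‖x‖⁻¹ • x)
        (by rw [norm_smul, norm_inv, norm_norm, inv_mul_cancel₀ hn.ne']) (ε / ‖x‖) (by positivity) 0
      refine ⟨k + 1, ‖x‖ • σ k, Submodule.smul_mem _ _ (hσH k), ?_⟩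
      have e1 : x - ‖x‖ • σ k = ‖x‖ • (‖x‖⁻¹ • x - σ k) := by
        rw [smul_sub, smul_smul, mul_inv_cancel₀ hn.ne', one_smul]
      rw [e1, norm_smul, norm_norm]
      rw [lt_div_iff₀ hn] at hk
      linarith
  let Y : Subspace ℝ (X →L[ℝ] ℝ) :=
    { carrier := {f | ∀ᶠ k in Filter.atTop, f (e k) = f (σ k)}
      zero_mem' := by simp
      add_mem' := by
        intro f g hf hg
        filter_upwards [hf, hg] with k h1 h2
        simp [h1, h2]
      smul_mem' := by
        intro a f hf
        filter_upwards [hf] with k h1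
        simp [h1] }
  have hYmem : ∀ f : X →L[ℝ] ℝ, f ∈ Y ↔ ∀ᶠ k in Filter.atTop, f (e k) = f (σ k) := fun f => Iff.rfl
  refine ⟨Y, ?_, ?_⟩
  · intro x
    have hub : ∀ r ∈ {r : ℝ | ∃ f ∈ Y, ‖f‖ ≤ 1 ∧ r = |f x|}, r ≤ ‖x‖ := by
      rintro r ⟨f, -, hf1, rfl⟩
      simpa using f.le_of_opNorm_le hf1 x
    refine le_antisymm ?_ (csSup_le ⟨_, 0, Y.zero_mem, by simp, rfl⟩ hub)
    apply le_of_forall_pos_le_add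
    intro ε hε
    obtain ⟨N, u, hu, hxu⟩ := happ x (ε / 3) (by positivity)
    obtain ⟨m, hmN, hcm⟩ : ∃ m ≥ N, ‖u‖ - ε / 3 ≤ c m * ‖u‖ := by
      have h1 : Filter.Tendsto (fun m => c m * ‖u‖) Filter.atTop (nhds (1 * ‖u‖)) :=
        hclim.mul_const _
      have h2 := h1.eventually (lt_mem_nhds (by linarith : ‖u‖ - ε/3 < 1 * ‖u‖))
      obtain ⟨m, h3, h4⟩ := (h2.and (Filter.eventually_ge_atTop N)).exists
      exact ⟨m, h4, h3.le⟩
    have hum : u ∈ H m := hmono hmN hu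
    let W : ℕ → Submodule ℝ X := fun M =>
      Submodule.span ℝ {z | ∃ k, m ≤ k ∧ k < M ∧ z = e k - σ k}
    have hWmono : Monotone W := fun M M' h => Submodule.span_mono (by
      rintro z ⟨k, h1, h2, h3⟩; exact ⟨k, h1, by omega, h3⟩)
    have hWH : ∀ M, W M ≤ H M := fun M => Submodule.span_le.2 (by
      rintro z ⟨k, h1, h2, rfl⟩
      exact Submodule.sub_mem _ (hmono (by omega) (heH k)) (hmono (by omega) (hσH k)))
    have hbound : ∀ M, m ≤ M → ∀ z ∈ W M, c m * ‖u‖ ≤ c M * ‖u + z‖ := by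
      intro M hM
      induction M, hM using Nat.le_induction with
      | base =>
        intro z hz
        have : {z | ∃ k, m ≤ k ∧ k < m ∧ z = e k - σ k} = (∅ : Set X) := by
          ext z
          simp only [Set.mem_setOf_eq, Set.mem_empty_iff_false, iff_false]
          rintro ⟨k, h1, h2, -⟩
          omega
        simp only [W, this, Submodule.span_empty, Submodule.mem_bot] at hz
        simp [hz]
      | succ M hM ih =>
        intro z hz
        have hle : W (M+1) ≤ W M ⊔ Submodule.span ℝ {e M - σ M} := Submodule.span_le.2 (by
          rintro z ⟨k, h1, h2, rfl⟩
          rcases Nat.lt_succ_iff_lt_or_eq.1 h2 with h | rfl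
          · exact Submodule.mem_sup_left (Submodule.subset_span ⟨k, h1, h, rfl⟩)
          · exact Submodule.mem_sup_right (Submodule.mem_span_singleton_self _))
        obtain ⟨w, hw, w', hw', rfl⟩ := Submodule.mem_sup.1 (hle hz)
        obtain ⟨a, rfl⟩ := Submodule.mem_span_singleton.1 hw'
        have h1 := ih w hw
        have h2 := hkey' M (u + w) (Submodule.add_mem _ (hmono hM hum) (hWH M hw)) (-a) a
        have e1 : u + (w + a • (e M - σ M)) = (u + w + (-a) • σ M) + a • e M := by module
        rw [e1]
        refine h1.trans (le_trans ?_ h2)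
        apply mul_le_mul_of_nonneg_left _ (hcpos M).le
        have e2 : u + w = (u + w + (-a) • σ M) + a • σ M := by module
        have h3 := norm_add_le (u + w + (-a) • σ M) (a • σ M)
        rw [← e2, norm_smul, hσ1, mul_one, Real.norm_eq_abs] at h3
        exact h3
    have hZ : ∀ z ∈ Submodule.span ℝ {z | ∃ k, m ≤ k ∧ z = e k - σ k}, ∃ M, m ≤ M ∧ z ∈ W M := by
      intro z hz
      induction hz using Submodule.span_induction with
      | mem z hz =>
        obtain ⟨k, h1, rfl⟩ := hz
        exact ⟨k + 1, by omega, Submodule.subset_span ⟨k, h1, by omega, rfl⟩⟩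
      | zero => exact ⟨m, le_rfl, Submodule.zero_mem _⟩
      | add x y _ _ hx hy =>
        obtain ⟨M1, h1, h2⟩ := hx
        obtain ⟨M2, h3, h4⟩ := hy
        exact ⟨max M1 M2, by omega, Submodule.add_mem _ (hWmono (le_max_left _ _) h2)
          (hWmono (le_max_right _ _) h4)⟩
      | smul a x _ hx =>
        obtain ⟨M1, h1, h2⟩ := hx
        exact ⟨M1, h1, Submodule.smul_mem _ _ h2⟩
    obtain ⟨f, hf1, hfu, hf0⟩ := exists_functional
      (Submodule.span ℝ {z | ∃ k, m ≤ k ∧ z = e k - σ k}) u (c m * ‖u‖) (by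
        intro z hz
        obtain ⟨M, hM, hzM⟩ := hZ z hz
        have h1 := hbound M hM z hzM
        have h2 := hclt M
        nlinarith [norm_nonneg (u + z)])
    have hfY : f ∈ Y := by
      rw [hYmem]
      filter_upwards [Filter.eventually_ge_atTop m] with k hk
      have := hf0 (e k - σ k) (Submodule.subset_span ⟨k, hk, rfl⟩)
      rw [map_sub] at this
      linarith
    have h1 : |f x| ≤ sSup {r : ℝ | ∃ f ∈ Y, ‖f‖ ≤ 1 ∧ r = |f x|} :=
      le_csSup ⟨_, hub⟩ ⟨f, hfY, hf1, rfl⟩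
    have h2 : |f (x - u)| ≤ 1 * ‖x - u‖ := by simpa using f.le_of_opNorm_le hf1 (x - u)
    rw [map_sub] at h2
    have h3 := (abs_le.1 h2).1
    have h4 := le_abs_self (f x)
    have h5 : ‖x‖ ≤ ‖x - u‖ + ‖u‖ := by simpa using norm_add_le (x - u) u
    have h6 : ‖u‖ - ε / 3 ≤ f u := hcm.trans hfu
    linarith
  · intro x f hf
    rw [hYmem] at hf
    rw [ContinuousLinearMap.norm_smulRight_apply]
    apply le_antisymm
    · refine (norm_add_le _ _).trans ?_
      rw [ContinuousLinearMap.norm_smulRight_apply, ContinuousLinearMap.norm_id]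
    · have asym : ∀ w : X, ∀ ε > 0, ∀ᶠ k in Filter.atTop, 1 + ‖w‖ - ε ≤ ‖e k + w‖ := by
        intro w ε hε
        obtain ⟨N, u, hu, hwu⟩ := happ w (ε / 3) (by positivity)
        have h1 : Filter.Tendsto (fun m => c m * (‖u‖ + 1)) Filter.atTop (nhds (1 * (‖u‖ + 1))) :=
          hclim.mul_const _
        have h2 := h1.eventually (lt_mem_nhds (by linarith : (‖u‖ + 1) - ε/3 < 1 * (‖u‖ + 1)))
        filter_upwards [h2, Filter.eventually_ge_atTop N] with k hk1 hk2
        have h3 := hkey' k u (hmono hk2 hu) 0 1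
        simp only [zero_smul, add_zero, abs_one, one_smul] at h3
        have h4 := hclt (k+1)
        have h5 : ‖u‖ + 1 - ε / 3 ≤ ‖u + e k‖ := by nlinarith [norm_nonneg (u + e k)]
        have h6 : ‖w‖ ≤ ‖w - u‖ + ‖u‖ := by simpa using norm_add_le (w - u) u
        have h7 : ‖u + e k‖ ≤ ‖e k + w‖ + ‖w - u‖ := by
          have : u + e k = (e k + w) - (w - u) := by abel
          rw [this]; exact norm_sub_le _ _
        linarith
      apply le_of_forall_pos_le_add
      intro ε' hε'
      obtain ⟨ε, hε, hεε⟩ : ∃ ε > 0, ε * (1 + 2 * ‖x‖) ≤ ε' :=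
        ⟨ε' / (1 + 2 * ‖x‖), by positivity, by rw [div_mul_cancel₀]; positivity⟩
      -- a unit vector almost norming `f`
      obtain ⟨v, hv1, hfv⟩ : ∃ v : X, ‖v‖ = 1 ∧ ‖f‖ - ε ≤ f v := by
        by_contra! h
        have hb : ∀ v : X, ‖v‖ = 1 → ‖f v‖ ≤ ‖f‖ - ε := by
          intro v hv
          rw [Real.norm_eq_abs, abs_le]
          have h1 := h v hv
          have h2 := h (-v) (by rwa [norm_neg])
          rw [map_neg] at h2
          constructor <;> linarith
        have := f.opNorm_le_of_unit_norm (C := ‖f‖ - ε) ((norm_nonneg _).trans (hb v0 hv0)) hb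
        linarith
      obtain ⟨N, hN⟩ := Filter.eventually_atTop.1 (hf.and (asym (‖f‖ • x) ε hε))
      obtain ⟨k, hkN, hk⟩ := hdense v hv1 (ε / (‖f‖ + 1)) (by positivity) N
      obtain ⟨hk1, hk2⟩ := hN k hkN
      have h1 : |f (v - σ k)| ≤ ‖f‖ * ‖v - σ k‖ := f.le_opNorm _
      have h2 : ‖f‖ * ‖v - σ k‖ ≤ ε := by
        rw [lt_div_iff₀ (by positivity)] at hk
        nlinarith [norm_nonneg (v - σ k), norm_nonneg f]
      rw [map_sub] at h1
      have h3 := (abs_le.1 (h1.trans h2)).2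
      have h4 : ‖f‖ - 2 * ε ≤ f (e k) := by rw [hk1]; linarith
      have h5 : f (e k) ≤ ‖f‖ := by
        have := f.le_opNorm (e k)
        rw [he1, mul_one, Real.norm_eq_abs] at this
        exact (le_abs_self _).trans this
      have h6 := (ContinuousLinearMap.id ℝ X + ContinuousLinearMap.smulRight f x).le_opNorm (e k)
      rw [he1, mul_one] at h6
      simp only [ContinuousLinearMap.add_apply, ContinuousLinearMap.id_apply,
        ContinuousLinearMap.smulRight_apply] at h6
      have h7 : ‖e k + ‖f‖ • x‖ ≤ ‖e k + f (e k) • x‖ + (‖f‖ - f (e k)) * ‖x‖ := by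
        have e1 : e k + ‖f‖ • x = (e k + f (e k) • x) + (‖f‖ - f (e k)) • x := by module
        have := norm_add_le (e k + f (e k) • x) ((‖f‖ - f (e k)) • x)
        rw [← e1, norm_smul, Real.norm_of_nonneg (by linarith : 0 ≤ ‖f‖ - f (e k))] at this
        exact this
      rw [norm_smul, norm_norm] at hk2
      have h8 : (‖f‖ - f (e k)) * ‖x‖ ≤ 2 * ε * ‖x‖ :=
        mul_le_mul_of_nonneg_right (by linarith) (norm_nonneg _)
      linarith

end aux

theorem stmt_8 {X : Type*} [NormedAddCommGroup X] [NormedSpace ℝ X]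
    [CompleteSpace X] [TopologicalSpace.SeparableSpace X]
    (hX : AlmostDaugavet X)
    (J Jhat : Subspace ℝ X) (hJc : IsClosed (J : Set X)) (hJhc : IsClosed (Jhat : Set X))
    (hsum : ∀ x : X, ∃ j ∈ J, ∃ jh ∈ Jhat, x = j + jh)
    (hdisj : J ⊓ Jhat = ⊥)
    (hL : ∀ j ∈ J, ∀ jh ∈ Jhat, ‖j + jh‖ = ‖j‖ + ‖jh‖) :
    AlmostDaugavet J ∨ AlmostDaugavet Jhat := by
  have : SecondCountableTopology X := UniformSpace.secondCountable_of_separable X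
  rcases thick_split (thick_of_ad hX) J Jhat hsum hL with h | h
  · exact Or.inl (ad_of_thick h)
  · exact Or.inr (ad_of_thick h)
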